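/- (Rewriting cuts along path extensions.) Let L ← K → R be a left-linear ma-rule over Σ, let p : G' → P be a path extension of an ma-hypergraph G', and let m : L → P be a convex match admitting a boundary complement. Then m factors as p ∘ m' for a mono m' : L → G', the convex rewrite of G' at m' exists, and it extends to the convex rewriting step of P at m via a commuting diagram of pushouts L ← K → R over G' ← C' → H' over P ← D → Q; furthermore the resulting mono q : H' → Q is again a path extension. -/

import Mathlib

namespace HypRw

/-- A hypergraph over a signature `Sg` with arity `ar` and coarity `coar`:
finite sets of nodes and hyperedges, source and target lists, and labels
compatible with arities. -/
structure Hypergraph (Sg : Type) (ar coar : Sg → ℕ) : Type 1 where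
  V : Type
  E : Type
  fintV : Fintype V
  fintE : Fintype E
  label : E → Sg
  src : E → List V
  tgt : E → List V
  src_len : ∀ e, (src e).length = ar (label e)
  tgt_len : ∀ e, (tgt e).length = coar (label e)

attribute [instance] Hypergraph.fintV Hypergraph.fintE

variable {Sg : Type} {ar coar : Sg → ℕ}

/-- Morphisms of hypergraphs: functions on nodes and hyperedges preserving
sources, targets and labels. -/
structure Hom (G H : Hypergraph Sg ar coar) : Type where
  onV : G.V → H.V
  onE : G.E → H.E
  label_eq : ∀ e, H.label (onE e) = G.label e
  src_eq : ∀ e, H.src (onE e) = (G.src e).map onV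
  tgt_eq : ∀ e, H.tgt (onE e) = (G.tgt e).map onV

def Hom.comp {G H K : Hypergraph Sg ar coar} (g : Hom H K) (f : Hom G H) : Hom G K where
  onV := g.onV ∘ f.onV
  onE := g.onE ∘ f.onE
  label_eq e := by simp [Function.comp, g.label_eq, f.label_eq]
  src_eq e := by simp [Function.comp, g.src_eq, f.src_eq, List.map_map]
  tgt_eq e := by simp [Function.comp, g.tgt_eq, f.tgt_eq, List.map_map]

def Hom.id (G : Hypergraph Sg ar coar) : Hom G G where
  onV := _root_.id
  onE := _root_.id
  label_eq e := rfl
  src_eq e := by simp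
  tgt_eq e := by simp

/-- A morphism is mono iff it is injective on nodes and hyperedges. -/
def IsMono {G H : Hypergraph Sg ar coar} (f : Hom G H) : Prop :=
  Function.Injective f.onV ∧ Function.Injective f.onE

/-- In-degree of a node: the number of pairs (h,i) with `v` the i-th target of `h`. -/
noncomputable def Hypergraph.inDegree (G : Hypergraph Sg ar coar) (v : G.V) : ℕ :=
  letI := Classical.decEq G.V
  ∑ e : G.E, (G.tgt e).count v

/-- Out-degree of a node: the number of pairs (h,i) with `v` the i-th source of `h`. -/
noncomputable def Hypergraph.outDegree (G : Hypergraph Sg ar coar) (v : G.V) : ℕ :=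
  letI := Classical.decEq G.V
  ∑ e : G.E, (G.src e).count v

def Hypergraph.IsInput (G : Hypergraph Sg ar coar) (v : G.V) : Prop := G.inDegree v = 0
def Hypergraph.IsOutput (G : Hypergraph Sg ar coar) (v : G.V) : Prop := G.outDegree v = 0

/-- Two hyperedges are consecutive in a path when some target of the first is a
source of the second. -/
def EdgeStep (G : Hypergraph Sg ar coar) (e e' : G.E) : Prop :=
  ∃ v, v ∈ G.tgt e ∧ v ∈ G.src e'

/-- `p` is a (directed) path in `G` from node `x` to node `y`. -/
def IsPathFromTo (G : Hypergraph Sg ar coar) (p : List G.E) (x y : G.V) : Prop :=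
  ∃ hp : p ≠ [], List.Chain' (EdgeStep G) p ∧
    x ∈ G.src (p.head hp) ∧ y ∈ G.tgt (p.getLast hp)

def HasPath (G : Hypergraph Sg ar coar) (x y : G.V) : Prop :=
  ∃ p, IsPathFromTo G p x y

/-- `G` contains a (directed) cycle. -/
def Hypergraph.HasCycle (G : Hypergraph Sg ar coar) : Prop :=
  ∃ (p : List G.E) (hp : p ≠ []), List.Chain' (EdgeStep G) p ∧
    EdgeStep G (p.getLast hp) (p.head hp)

/-- Every node has in-degree ≤ 1 and out-degree ≤ 1. -/
def Hypergraph.Monogamous (G : Hypergraph Sg ar coar) : Prop :=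
  ∀ v, G.inDegree v ≤ 1 ∧ G.outDegree v ≤ 1

/-- Monogamous acyclic hypergraph. -/
def Hypergraph.IsMA (G : Hypergraph Sg ar coar) : Prop :=
  ¬ G.HasCycle ∧ G.Monogamous

/-- `m' : G → H'` path-covers `m : G → H` (written m ≲ m'): the path relation
`R_m ⊆ out(G) × in(G)` is contained in `R_{m'}`. -/
def PathCovers {G H H' : Hypergraph Sg ar coar} (m : Hom G H) (m' : Hom G H') : Prop :=
  ∀ y x, G.IsOutput y → G.IsInput x →
    HasPath H (m.onV y) (m.onV x) → HasPath H' (m'.onV y) (m'.onV x)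

/-- An ma-cospan `n → G ← m` (interfaces discrete): `G` is ma, the legs are
injective with images exactly the inputs resp. outputs of `G`. -/
def IsMACospan (G : Hypergraph Sg ar coar) {α β : Type}
    (i : α → G.V) (o : β → G.V) : Prop :=
  G.IsMA ∧ Function.Injective i ∧ Set.range i = {v | G.IsInput v} ∧
    Function.Injective o ∧ Set.range o = {v | G.IsOutput v}

/-- Every input is connected by a path to every output. -/
def Hypergraph.StronglyConnected (G : Hypergraph Sg ar coar) : Prop :=
  ∀ x y, G.IsInput x → G.IsOutput y → HasPath G x y

/-- The discrete hypergraph on a finite set of nodes. -/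
def Discrete (α : Type) [Fintype α] : Hypergraph Sg ar coar where
  V := α
  E := Empty
  fintV := inferInstance
  fintE := inferInstance
  label e := e.elim
  src e := e.elim
  tgt e := e.elim
  src_len e := e.elim
  tgt_len e := e.elim

/-- The hypergraph morphism from a discrete hypergraph induced by a function on nodes. -/
def discHom {α : Type} [Fintype α] (G : Hypergraph Sg ar coar) (f : α → G.V) :
    Hom (Discrete α) G where
  onV := f
  onE e := e.elim
  label_eq e := e.elim
  src_eq e := e.elim
  tgt_eq e := e.elim

/-- Pushout square of hypergraphs (universal property). -/
def IsPushout {A B C D : Hypergraph Sg ar coar}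
    (f : Hom A B) (g : Hom A C) (h : Hom B D) (k : Hom C D) : Prop :=
  h.comp f = k.comp g ∧
    ∀ (X : Hypergraph Sg ar coar) (u : Hom B X) (v : Hom C X),
      u.comp f = v.comp g → ∃! w : Hom D X, w.comp h = u ∧ w.comp k = v

/-- Pullback square of hypergraphs (universal property). -/
def IsPullback {A B C D : Hypergraph Sg ar coar}
    (p : Hom A B) (q : Hom A C) (f : Hom B D) (g : Hom C D) : Prop :=
  f.comp p = g.comp q ∧
    ∀ (X : Hypergraph Sg ar coar) (u : Hom X B) (v : Hom X C),
      f.comp u = g.comp v → ∃! w : Hom X A, p.comp w = u ∧ q.comp w = v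

/-- A convex match: a mono whose image is convex, i.e. every path in `G`
between two nodes of the image has all its hyperedges in the image. -/
def IsConvexMatch {L G : Hypergraph Sg ar coar} (f : Hom L G) : Prop :=
  IsMono f ∧
    ∀ (v v' : L.V) (p : List G.E) (hp : p ≠ []),
      List.Chain' (EdgeStep G) p →
      f.onV v ∈ G.src (p.head hp) → f.onV v' ∈ G.tgt (p.getLast hp) →
      ∀ e ∈ p, ∃ e₀, f.onE e₀ = e

/-- An ma-rule `L ← i+j → R`: both `i → L ← j` and `i → R ← j` are ma-cospans. -/
structure MARule (Sg : Type) (ar coar : Sg → ℕ) : Type 1 where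
  i : ℕ
  j : ℕ
  L : Hypergraph Sg ar coar
  R : Hypergraph Sg ar coar
  lhsIn : Fin i → L.V
  lhsOut : Fin j → L.V
  rhsIn : Fin i → R.V
  rhsOut : Fin j → R.V
  ma_lhs : IsMACospan L lhsIn lhsOut
  ma_rhs : IsMACospan R rhsIn rhsOut

/-- A rule is left-linear when `i+j → L` is mono. -/
def MARule.IsLeftLinear (r : MARule Sg ar coar) : Prop :=
  Function.Injective (Sum.elim r.lhsIn r.lhsOut)

/-- A boundary complement of a mono `f : L → G` with respect to ma-cospans
`i → L ← j` and `n → G ← m`: a pushout complement `i+j → C → G` with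
`i+j → C` mono, together with `d1, d2` making `j+n → C ← m+i` an ma-cospan. -/
structure BoundaryComplement {i j n m : ℕ} {L G : Hypergraph Sg ar coar}
    (a1 : Fin i → L.V) (a2 : Fin j → L.V) (b1 : Fin n → G.V) (b2 : Fin m → G.V)
    (f : Hom L G) : Type 1 where
  C : Hypergraph Sg ar coar
  c1 : Fin i → C.V
  c2 : Fin j → C.V
  g : Hom C G
  po : IsPushout (discHom L (Sum.elim a1 a2)) (discHom C (Sum.elim c1 c2)) f g
  c_mono : Function.Injective (Sum.elim c1 c2)
  d1 : Fin n → C.V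
  d2 : Fin m → C.V
  g_d1 : g.onV ∘ d1 = b1
  g_d2 : g.onV ∘ d2 = b2
  bc_ma : IsMACospan C (Sum.elim c2 d1) (Sum.elim d2 c1)

/-- The data of a convex DPO rewriting step `(D ← n+m) ⇝ (E ← n+m)` applying an
ma-rule `r` at a convex match via a boundary complement. -/
structure StepData (r : MARule Sg ar coar) {n m : ℕ}
    (D : Hypergraph Sg ar coar) (dIn : Fin n → D.V) (dOut : Fin m → D.V)
    (E : Hypergraph Sg ar coar) (eIn : Fin n → E.V) (eOut : Fin m → E.V) : Type 1 where
  f : Hom r.L D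
  C : Hypergraph Sg ar coar
  c1 : Fin r.i → C.V
  c2 : Fin r.j → C.V
  g : Hom C D
  h : Hom C E
  comatch : Hom r.R E
  d1 : Fin n → C.V
  d2 : Fin m → C.V
  maD : IsMACospan D dIn dOut
  maE : IsMACospan E eIn eOut
  convex : IsConvexMatch f
  po_left : IsPushout (discHom r.L (Sum.elim r.lhsIn r.lhsOut))
    (discHom C (Sum.elim c1 c2)) f g
  c_mono : Function.Injective (Sum.elim c1 c2)
  g_d1 : g.onV ∘ d1 = dIn
  g_d2 : g.onV ∘ d2 = dOut
  bc_ma : IsMACospan C (Sum.elim c2 d1) (Sum.elim d2 c1)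
  po_right : IsPushout (discHom r.R (Sum.elim r.rhsIn r.rhsOut))
    (discHom C (Sum.elim c1 c2)) comatch h
  h_d1 : h.onV ∘ d1 = eIn
  h_d2 : h.onV ∘ d2 = eOut

/-- Convex rewriting step with respect to a rewriting system `Rs`. -/
def ConvexStep (Rs : Set (MARule Sg ar coar)) {n m : ℕ}
    (D : Hypergraph Sg ar coar) (dIn : Fin n → D.V) (dOut : Fin m → D.V)
    (E : Hypergraph Sg ar coar) (eIn : Fin n → E.V) (eOut : Fin m → E.V) : Prop :=
  ∃ r ∈ Rs, Nonempty (StepData r D dIn dOut E eIn eOut)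

/-- A hypergraph with an (n,m)-interface. -/
structure IGraph (Sg : Type) (ar coar : Sg → ℕ) (n m : ℕ) : Type 1 where
  G : Hypergraph Sg ar coar
  iIn : Fin n → G.V
  iOut : Fin m → G.V

def StepRel (Rs : Set (MARule Sg ar coar)) {n m : ℕ}
    (X Y : IGraph Sg ar coar n m) : Prop :=
  ConvexStep Rs X.G X.iIn X.iOut Y.G Y.iIn Y.iOut

/-- Joinability: both rewrite (in finitely many convex steps) to a common
ma-hypergraph with interface. -/
def Joinable (Rs : Set (MARule Sg ar coar)) {n m : ℕ}
    (X Y : IGraph Sg ar coar n m) : Prop :=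
  ∃ W, Relation.ReflTransGen (StepRel Rs) X W ∧ Relation.ReflTransGen (StepRel Rs) Y W

/-- An ma-pre-critical pair: two convex rewriting steps from a common source
`S ← n+m` such that the combined match `L1 + L2 → S` is epi and `S ← n+m` is an
ma-hypergraph with interface. -/
structure MAPreCriticalPair (r1 r2 : MARule Sg ar coar) {n m : ℕ}
    (S : Hypergraph Sg ar coar) (sIn : Fin n → S.V) (sOut : Fin m → S.V)
    (H1 : Hypergraph Sg ar coar) (h1In : Fin n → H1.V) (h1Out : Fin m → H1.V)
    (H2 : Hypergraph Sg ar coar) (h2In : Fin n → H2.V) (h2Out : Fin m → H2.V) :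
    Type 1 where
  step1 : StepData r1 S sIn sOut H1 h1In h1Out
  step2 : StepData r2 S sIn sOut H2 h2In h2Out
  epiV : ∀ v : S.V, (∃ x, step1.f.onV x = v) ∨ (∃ x, step2.f.onV x = v)
  epiE : ∀ e : S.E, (∃ x, step1.f.onE x = e) ∨ (∃ x, step2.f.onE x = e)

/-! ### The extended signature Σ + 𝒫 with the three formal path generators -/

abbrev ESig (Sg : Type) : Type := Sg ⊕ Fin 3

/-- Arities of Σ + 𝒫: the generators have arities 2, 1, 1. -/
def ear (ar : Sg → ℕ) : ESig Sg → ℕ :=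
  Sum.elim ar (fun g => if g = (0 : Fin 3) then 2 else 1)

/-- Coarities of Σ + 𝒫: the generators have coarities 1, 2, 1. -/
def ecoar (coar : Sg → ℕ) : ESig Sg → ℕ :=
  Sum.elim coar (fun g => if g = (1 : Fin 3) then 2 else 1)

abbrev EHypergraph (Sg : Type) (ar coar : Sg → ℕ) : Type 1 :=
  Hypergraph (ESig Sg) (ear ar) (ecoar coar)

/-- A hypergraph over Σ + 𝒫 labelled only by Σ. -/
def Pure (G : EHypergraph Sg ar coar) : Prop :=
  ∀ e : G.E, (G.label e).isLeft = true

/-- A path extension of `G` realizing the relation `R ⊆ out(G) × in(G)`: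
a mono `p : G → P` whose complement consists only of extra nodes and
𝒫-labelled hyperedges, with a path in `P` from `p y` to `p x` (for `y` an
output and `x` an input of `G`) iff `(y,x) ∈ R`. -/
def IsPathExtension {G P : EHypergraph Sg ar coar}
    (p : Hom G P) (R : G.V → G.V → Prop) : Prop :=
  IsMono p ∧ (∀ e : P.E, (¬ ∃ e₀, p.onE e₀ = e) → (P.label e).isRight = true) ∧
    ∀ y x, G.IsOutput y → G.IsInput x → (HasPath P (p.onV y) (p.onV x) ↔ R y x)

/-- A path extension (realizing its own path relation). -/
def IsPathExt {G P : EHypergraph Sg ar coar} (p : Hom G P) : Prop :=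
  IsMono p ∧ ∀ e : P.E, (¬ ∃ e₀, p.onE e₀ = e) → (P.label e).isRight = true

/-- Condition (1)-(2) of Definition of maximal path relations: `R` is the path
relation of some mono of `S` into an ma-hypergraph for which both induced
matches are convex. -/
def SatPR {r1 r2 : MARule (ESig Sg) (ear ar) (ecoar coar)} {n m : ℕ}
    {S : EHypergraph Sg ar coar} {sIn : Fin n → S.V} {sOut : Fin m → S.V}
    {H1 : EHypergraph Sg ar coar} {h1In : Fin n → H1.V} {h1Out : Fin m → H1.V}
    {H2 : EHypergraph Sg ar coar} {h2In : Fin n → H2.V} {h2Out : Fin m → H2.V}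
    (cp : MAPreCriticalPair r1 r2 S sIn sOut H1 h1In h1Out H2 h2In h2Out)
    (R : S.V → S.V → Prop) : Prop :=
  ∃ (H : EHypergraph Sg ar coar) (mh : Hom S H), IsMono mh ∧ H.IsMA ∧
    (∀ y x, R y x ↔ (S.IsOutput y ∧ S.IsInput x ∧ HasPath H (mh.onV y) (mh.onV x))) ∧
    IsConvexMatch (mh.comp cp.step1.f) ∧ IsConvexMatch (mh.comp cp.step2.f)

/-- A maximal path relation for an ma-pre-critical pair. -/
def MaxPR {r1 r2 : MARule (ESig Sg) (ear ar) (ecoar coar)} {n m : ℕ}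
    {S : EHypergraph Sg ar coar} {sIn : Fin n → S.V} {sOut : Fin m → S.V}
    {H1 : EHypergraph Sg ar coar} {h1In : Fin n → H1.V} {h1Out : Fin m → H1.V}
    {H2 : EHypergraph Sg ar coar} {h2In : Fin n → H2.V} {h2Out : Fin m → H2.V}
    (cp : MAPreCriticalPair r1 r2 S sIn sOut H1 h1In h1Out H2 h2In h2Out)
    (R : S.V → S.V → Prop) : Prop :=
  SatPR cp R ∧ ∀ R', SatPR cp R' → (∀ y x, R y x → R' y x) → ∀ y x, R' y x → R y x

/-- An ma-pre-critical pair is path joinable if for every maximal path relation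
`R` there is a path extension `p` with `R_p = R` such that the branching
obtained by lifting the two rewriting steps along `p` is joinable by convex
rewriting. -/
def PathJoinable (Rs : Set (MARule (ESig Sg) (ear ar) (ecoar coar)))
    {r1 r2 : MARule (ESig Sg) (ear ar) (ecoar coar)} {n m : ℕ}
    {S : EHypergraph Sg ar coar} {sIn : Fin n → S.V} {sOut : Fin m → S.V}
    {H1 : EHypergraph Sg ar coar} {h1In : Fin n → H1.V} {h1Out : Fin m → H1.V}
    {H2 : EHypergraph Sg ar coar} {h2In : Fin n → H2.V} {h2Out : Fin m → H2.V}
    (cp : MAPreCriticalPair r1 r2 S sIn sOut H1 h1In h1Out H2 h2In h2Out) : Prop :=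
  ∀ R, MaxPR cp R →
    ∃ (P : EHypergraph Sg ar coar) (p : Hom S P), IsPathExtension p R ∧
      ∃ (pIn : Fin n → P.V) (pOut : Fin m → P.V)
        (P1 : EHypergraph Sg ar coar) (p1In : Fin n → P1.V) (p1Out : Fin m → P1.V)
        (P2 : EHypergraph Sg ar coar) (p2In : Fin n → P2.V) (p2Out : Fin m → P2.V)
        (sd1 : StepData r1 P pIn pOut P1 p1In p1Out)
        (sd2 : StepData r2 P pIn pOut P2 p2In p2Out),
        sd1.f = p.comp cp.step1.f ∧ sd2.f = p.comp cp.step2.f ∧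
        Joinable Rs ⟨P1, p1In, p1Out⟩ ⟨P2, p2In, p2Out⟩

theorem Hom.ext_of_eq {G H : Hypergraph Sg ar coar} {f g : Hom G H}
    (hV : ∀ v, f.onV v = g.onV v) (hE : ∀ e, f.onE e = g.onE e) : f = g := by
  obtain ⟨fV, fE, _, _, _⟩ := f
  obtain ⟨gV, gE, _, _, _⟩ := g
  obtain rfl : fV = gV := funext hV
  obtain rfl : fE = gE := funext hE
  rfl

/-! ### Degrees and cycles in terms of incidence -/

theorem Hypergraph.isInput_iff {G : Hypergraph Sg ar coar} {v : G.V} :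
    G.IsInput v ↔ ∀ e, v ∉ G.tgt e := by
  simp [Hypergraph.IsInput, Hypergraph.inDegree, List.count_eq_zero]

theorem Hypergraph.isOutput_iff {G : Hypergraph Sg ar coar} {v : G.V} :
    G.IsOutput v ↔ ∀ e, v ∉ G.src e := by
  simp [Hypergraph.IsOutput, Hypergraph.outDegree, List.count_eq_zero]

theorem sum_count_le_one_iff {V E : Type} [Fintype E] [DecidableEq V] (f : E → List V) :
    (∀ v, ∑ e, (f e).count v ≤ 1) ↔
      (∀ e, (f e).Nodup) ∧ ∀ v e e', v ∈ f e → v ∈ f e' → e = e' := by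
  classical
  constructor
  · refine fun h => ⟨fun e => List.nodup_iff_count_le_one.2 fun v => ?_, fun v e e' he he' => ?_⟩
    · exact (Finset.single_le_sum (f := fun e => (f e).count v) (fun _ _ => Nat.zero_le _)
        (Finset.mem_univ e)).trans (h v)
    · by_contra hne
      have h1 := List.count_pos_iff.2 he
      have h2 := List.count_pos_iff.2 he'
      have h3 : ∑ x ∈ ({e, e'} : Finset E), (f x).count v ≤ ∑ x, (f x).count v :=
        Finset.sum_le_sum_of_subset (Finset.subset_univ _)
      rw [Finset.sum_pair hne] at h3
      have := h v
      omega
  · rintro ⟨h1, h2⟩ v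
    by_cases hv : ∃ e, v ∈ f e
    · obtain ⟨e, he⟩ := hv
      rw [Finset.sum_eq_single e]
      · exact List.nodup_iff_count_le_one.1 (h1 e) v
      · intro b _ hb
        exact List.count_eq_zero.2 fun hv => hb (h2 v b e hv he)
      · simp
    · push Not at hv
      rw [Finset.sum_eq_zero fun e _ => List.count_eq_zero.2 (hv e)]
      exact Nat.zero_le _

theorem Hypergraph.monogamous_iff {G : Hypergraph Sg ar coar} :
    G.Monogamous ↔
      ((∀ e, (G.tgt e).Nodup) ∧ ∀ v e e', v ∈ G.tgt e → v ∈ G.tgt e' → e = e') ∧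
      ((∀ e, (G.src e).Nodup) ∧ ∀ v e e', v ∈ G.src e → v ∈ G.src e' → e = e') := by
  classical
  rw [← sum_count_le_one_iff, ← sum_count_le_one_iff, ← forall_and]
  refine forall_congr' fun v => ?_
  unfold Hypergraph.inDegree Hypergraph.outDegree
  convert Iff.rfl

theorem Hypergraph.IsMA.tgt_nodup {G : Hypergraph Sg ar coar} (h : G.IsMA) (e : G.E) :
    (G.tgt e).Nodup := (Hypergraph.monogamous_iff.1 h.2).1.1 e

theorem Hypergraph.IsMA.src_nodup {G : Hypergraph Sg ar coar} (h : G.IsMA) (e : G.E) :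
    (G.src e).Nodup := (Hypergraph.monogamous_iff.1 h.2).2.1 e

theorem Hypergraph.IsMA.tgt_unique {G : Hypergraph Sg ar coar} (h : G.IsMA) {v : G.V}
    {e e' : G.E} : v ∈ G.tgt e → v ∈ G.tgt e' → e = e' :=
  (Hypergraph.monogamous_iff.1 h.2).1.2 v e e'

theorem Hypergraph.IsMA.src_unique {G : Hypergraph Sg ar coar} (h : G.IsMA) {v : G.V}
    {e e' : G.E} : v ∈ G.src e → v ∈ G.src e' → e = e' :=
  (Hypergraph.monogamous_iff.1 h.2).2.2 v e e'

theorem Hypergraph.hasCycle_iff {G : Hypergraph Sg ar coar} :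
    G.HasCycle ↔ ∃ e, Relation.TransGen (EdgeStep G) e e := by
  constructor
  · rintro ⟨p, hp, hc, hs⟩
    cases p with
    | nil => exact absurd rfl hp
    | cons a l =>
      have := List.relationReflTransGen_of_exists_isChain_cons l hc rfl
      exact ⟨a, Relation.TransGen.tail' this hs⟩
  · rintro ⟨e, he⟩
    obtain ⟨e', h1, h2⟩ := Relation.TransGen.tail'_iff.1 he
    obtain ⟨l, hl, hl'⟩ := List.exists_isChain_cons_of_relationReflTransGen h1
    exact ⟨e :: l, by simp, hl, by rw [hl']; exact h2⟩

theorem IsConvexMatch.mem_range {L G : Hypergraph Sg ar coar} {f : Hom L G}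
    (h : IsConvexMatch f) {v v' : L.V} {e e' : G.E} (he : f.onV v ∈ G.src e)
    (hee : Relation.ReflTransGen (EdgeStep G) e e') (he' : f.onV v' ∈ G.tgt e') :
    ∃ e₀, f.onE e₀ = e := by
  obtain ⟨l, hl, hl'⟩ := List.exists_isChain_cons_of_relationReflTransGen hee
  exact h.2 v v' (e :: l) (by simp) hl he (by rw [hl']; exact he') e (by simp)

/-! ### A criterion for pushouts -/

theorem exists_desc_of_inter {A B C D X : Type} {f : A → B} {g : A → C} {h : B → D} {k : C → D}
    (hsurj : ∀ d, (∃ b, h b = d) ∨ ∃ c, k c = d) (hinj : Function.Injective h)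
    (hint : ∀ b c, h b = k c → ∃ a, f a = b ∧ g a = c)
    (hk : ∀ c c', k c = k c' → c = c' ∨ ∃ b, h b = k c)
    (u : B → X) (v : C → X) (huv : ∀ a, u (f a) = v (g a)) :
    ∃ w : D → X, (∀ b, w (h b) = u b) ∧ ∀ c, w (k c) = v c := by
  have key : ∀ d, ∃ x, (∀ b, h b = d → x = u b) ∧ ∀ c, k c = d → x = v c := by
    have glue : ∀ b c, h b = k c → u b = v c := by
      intro b c hbc
      obtain ⟨a, rfl, rfl⟩ := hint b c hbc
      exact huv a
    intro d
    rcases hsurj d with ⟨b, rfl⟩ | ⟨c, rfl⟩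
    · exact ⟨u b, fun b' hb' => by rw [hinj hb'], fun c hc => glue b c hc.symm⟩
    · refine ⟨v c, fun b hb => (glue b c hb).symm, fun c' hc' => ?_⟩
      rcases hk c c' hc'.symm with rfl | ⟨b, hb⟩
      · rfl
      · rw [← glue b c hb, ← glue b c' (hb.trans hc'.symm)]
  choose w hw1 hw2 using key
  exact ⟨w, fun b => hw1 _ b rfl, fun c => hw2 _ c rfl⟩

/-- A commuting square whose right leg `h` is mono is a pushout as soon as `h` and `k` are jointly
surjective, their images meet only in the image of `A`, and `k` identifies elements only inside
the image of `h`. -/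
theorem IsPushout.of_inter {A B C D : Hypergraph Sg ar coar}
    {f : Hom A B} {g : Hom A C} {h : Hom B D} {k : Hom C D}
    (comm : h.comp f = k.comp g) (hmono : IsMono h)
    (surjV : ∀ d, (∃ b, h.onV b = d) ∨ ∃ c, k.onV c = d)
    (intV : ∀ b c, h.onV b = k.onV c → ∃ a, f.onV a = b ∧ g.onV a = c)
    (kV : ∀ c c', k.onV c = k.onV c' → c = c' ∨ ∃ b, h.onV b = k.onV c)
    (surjE : ∀ d, (∃ b, h.onE b = d) ∨ ∃ c, k.onE c = d)
    (intE : ∀ b c, h.onE b = k.onE c → ∃ a, f.onE a = b ∧ g.onE a = c)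
    (kE : ∀ c c', k.onE c = k.onE c' → c = c' ∨ ∃ b, h.onE b = k.onE c) :
    IsPushout f g h k := by
  refine ⟨comm, fun X u v huv => ?_⟩
  obtain ⟨wV, hV1, hV2⟩ := exists_desc_of_inter surjV hmono.1 intV kV u.onV v.onV
    fun a => congrFun (congrArg Hom.onV huv) a
  obtain ⟨wE, hE1, hE2⟩ := exists_desc_of_inter surjE hmono.2 intE kE u.onE v.onE
    fun a => congrFun (congrArg Hom.onE huv) a
  have eV1 : wV ∘ h.onV = u.onV := funext hV1
  have eV2 : wV ∘ k.onV = v.onV := funext hV2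
  refine ⟨⟨wV, wE, fun e => ?_, fun e => ?_, fun e => ?_⟩,
    ⟨Hom.ext_of_eq hV1 hE1, Hom.ext_of_eq hV2 hE2⟩, ?_⟩
  · rcases surjE e with ⟨b, rfl⟩ | ⟨c, rfl⟩
    · rw [hE1, u.label_eq, h.label_eq]
    · rw [hE2, v.label_eq, k.label_eq]
  · rcases surjE e with ⟨b, rfl⟩ | ⟨c, rfl⟩
    · rw [hE1, u.src_eq, h.src_eq, List.map_map, eV1]
    · rw [hE2, v.src_eq, k.src_eq, List.map_map, eV2]
  · rcases surjE e with ⟨b, rfl⟩ | ⟨c, rfl⟩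
    · rw [hE1, u.tgt_eq, h.tgt_eq, List.map_map, eV1]
    · rw [hE2, v.tgt_eq, k.tgt_eq, List.map_map, eV2]
  · rintro w ⟨rfl, rfl⟩
    refine Hom.ext_of_eq (fun d => ?_) fun d => ?_
    · rcases surjV d with ⟨b, rfl⟩ | ⟨c, rfl⟩
      exacts [(hV1 b).symm, (hV2 c).symm]
    · rcases surjE d with ⟨b, rfl⟩ | ⟨c, rfl⟩
      exacts [(hE1 b).symm, (hE2 c).symm]

/-! ### Interfaces of ma-rules -/

namespace MARule

variable (r : MARule Sg ar coar)

/-- The map `i+j → L` on nodes. -/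
def lhs : Fin r.i ⊕ Fin r.j → r.L.V := Sum.elim r.lhsIn r.lhsOut

/-- The map `i+j → R` on nodes. -/
def rhs : Fin r.i ⊕ Fin r.j → r.R.V := Sum.elim r.rhsIn r.rhsOut

variable {r}

theorem exists_lhsIn_iff {l : r.L.V} : (∃ x, r.lhsIn x = l) ↔ ∀ e, l ∉ r.L.tgt e := by
  rw [← Hypergraph.isInput_iff]
  exact Set.ext_iff.1 r.ma_lhs.2.2.1 l

theorem exists_lhsOut_iff {l : r.L.V} : (∃ x, r.lhsOut x = l) ↔ ∀ e, l ∉ r.L.src e := by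
  rw [← Hypergraph.isOutput_iff]
  exact Set.ext_iff.1 r.ma_lhs.2.2.2.2 l

theorem exists_rhsIn_iff {v : r.R.V} : (∃ x, r.rhsIn x = v) ↔ ∀ e, v ∉ r.R.tgt e := by
  rw [← Hypergraph.isInput_iff]
  exact Set.ext_iff.1 r.ma_rhs.2.2.1 v

theorem exists_rhsOut_iff {v : r.R.V} : (∃ x, r.rhsOut x = v) ↔ ∀ e, v ∉ r.R.src e := by
  rw [← Hypergraph.isOutput_iff]
  exact Set.ext_iff.1 r.ma_rhs.2.2.2.2 v

theorem rhsIn_injective : Function.Injective r.rhsIn := r.ma_rhs.2.1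
theorem rhsOut_injective : Function.Injective r.rhsOut := r.ma_rhs.2.2.2.1

theorem IsLeftLinear.exists_edge (hr : r.IsLeftLinear) (l : r.L.V) :
    ∃ e, l ∈ r.L.src e ∨ l ∈ r.L.tgt e := by
  by_contra! h
  obtain ⟨x, hx⟩ := exists_lhsIn_iff.2 fun e => (h e).2
  obtain ⟨y, hy⟩ := exists_lhsOut_iff.2 fun e => (h e).1
  exact absurd (hr (a₁ := .inl x) (a₂ := .inr y) (hx.trans hy.symm)) (by simp)

theorem IsLeftLinear.lhsIn_ne_lhsOut (hr : r.IsLeftLinear) (x : Fin r.i) (y : Fin r.j) :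
    r.lhsIn x ≠ r.lhsOut y := fun h =>
  absurd (hr (a₁ := .inl x) (a₂ := .inr y) h) (by simp)

end MARule

/-- A convex match of the left-hand side of a left-linear ma-rule in an ma-hypergraph. -/
structure Redex (r : MARule Sg ar coar) (G : Hypergraph Sg ar coar) : Type where
  f : Hom r.L G
  leftLinear : r.IsLeftLinear
  isMA : G.IsMA
  convex : IsConvexMatch f

namespace Redex

variable {r : MARule Sg ar coar} {G : Hypergraph Sg ar coar} (S : Redex r G)

theorem injV : Function.Injective S.f.onV := S.convex.1.1

theorem mem_src_onE {l : r.L.V} {e : r.L.E} : S.f.onV l ∈ G.src (S.f.onE e) ↔ l ∈ r.L.src e := by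
  rw [S.f.src_eq, List.mem_map_of_injective S.injV]

theorem mem_tgt_onE {l : r.L.V} {e : r.L.E} : S.f.onV l ∈ G.tgt (S.f.onE e) ↔ l ∈ r.L.tgt e := by
  rw [S.f.tgt_eq, List.mem_map_of_injective S.injV]

theorem exists_lhsOut_of_mem_src {l : r.L.V} {e : G.E} (he : ¬ ∃ e₀, S.f.onE e₀ = e)
    (hl : S.f.onV l ∈ G.src e) : ∃ y, r.lhsOut y = l :=
  MARule.exists_lhsOut_iff.2 fun e' he' => he ⟨e', S.isMA.src_unique (S.mem_src_onE.2 he') hl⟩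

theorem exists_lhsIn_of_mem_tgt {l : r.L.V} {e : G.E} (he : ¬ ∃ e₀, S.f.onE e₀ = e)
    (hl : S.f.onV l ∈ G.tgt e) : ∃ x, r.lhsIn x = l :=
  MARule.exists_lhsIn_iff.2 fun e' he' => he ⟨e', S.isMA.tgt_unique (S.mem_tgt_onE.2 he') hl⟩

theorem exists_lhsOut_of_isOutput {l : r.L.V} (hl : G.IsOutput (S.f.onV l)) :
    ∃ y, r.lhsOut y = l :=
  MARule.exists_lhsOut_iff.2 fun _ he => Hypergraph.isOutput_iff.1 hl _ (S.mem_src_onE.2 he)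

theorem exists_lhsIn_of_isInput {l : r.L.V} (hl : G.IsInput (S.f.onV l)) :
    ∃ x, r.lhsIn x = l :=
  MARule.exists_lhsIn_iff.2 fun _ he => Hypergraph.isInput_iff.1 hl _ (S.mem_tgt_onE.2 he)

/-- Nodes of `G` surviving in the boundary complement. -/
def Keeps (v : G.V) : Prop := ∀ l, S.f.onV l = v → ∃ k, r.lhs k = l

theorem keeps_of_lhsOut {v : G.V} (h : ∀ l, S.f.onV l = v → ∃ y, r.lhsOut y = l) : S.Keeps v :=
  fun l hl => let ⟨y, hy⟩ := h l hl; ⟨.inr y, hy⟩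

theorem keeps_of_lhsIn {v : G.V} (h : ∀ l, S.f.onV l = v → ∃ x, r.lhsIn x = l) : S.Keeps v :=
  fun l hl => let ⟨x, hx⟩ := h l hl; ⟨.inl x, hx⟩

theorem keeps_of_mem_src {v : G.V} {e : G.E} (he : ¬ ∃ e₀, S.f.onE e₀ = e)
    (hv : v ∈ G.src e) : S.Keeps v :=
  S.keeps_of_lhsOut fun _ hl => S.exists_lhsOut_of_mem_src he (hl ▸ hv)

theorem keeps_of_mem_tgt {v : G.V} {e : G.E} (he : ¬ ∃ e₀, S.f.onE e₀ = e)
    (hv : v ∈ G.tgt e) : S.Keeps v :=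
  S.keeps_of_lhsIn fun _ hl => S.exists_lhsIn_of_mem_tgt he (hl ▸ hv)

open Classical in
/-- The boundary complement: remove from `G` the hyperedges and internal nodes of the match. -/
noncomputable def compl : Hypergraph Sg ar coar where
  V := {v : G.V // S.Keeps v}
  E := {e : G.E // ¬ ∃ e₀, S.f.onE e₀ = e}
  fintV := inferInstance
  fintE := inferInstance
  label e := G.label e.1
  src e := (G.src e.1).attachWith S.Keeps fun _ hv => S.keeps_of_mem_src e.2 hv
  tgt e := (G.tgt e.1).attachWith S.Keeps fun _ hv => S.keeps_of_mem_tgt e.2 hv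
  src_len e := by simp [G.src_len]
  tgt_len e := by simp [G.tgt_len]

/-- The inclusion of the boundary complement. -/
noncomputable def incl : Hom S.compl G where
  onV := Subtype.val
  onE := Subtype.val
  label_eq _ := rfl
  src_eq _ := (List.attachWith_map_subtype_val _).symm
  tgt_eq _ := (List.attachWith_map_subtype_val _).symm

theorem mem_compl_src {c : S.compl.V} {e : S.compl.E} : c ∈ S.compl.src e ↔ c.1 ∈ G.src e.1 :=
  List.mem_attachWith _ _

theorem mem_compl_tgt {c : S.compl.V} {e : S.compl.E} : c ∈ S.compl.tgt e ↔ c.1 ∈ G.tgt e.1 :=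
  List.mem_attachWith _ _

/-- The map `i+j → C` on nodes. -/
def bdry (k : Fin r.i ⊕ Fin r.j) : S.compl.V :=
  ⟨S.f.onV (r.lhs k), fun _ hl => ⟨k, (S.injV hl).symm⟩⟩

theorem bdry_injective : Function.Injective S.bdry := fun _ _ h =>
  S.leftLinear (S.injV (congrArg Subtype.val h))

/-- The nodes of the result of rewriting. -/
abbrev ResultV : Type := r.R.V ⊕ {v : G.V // ¬ ∃ l, S.f.onV l = v}

open Classical in
/-- The map from the boundary complement to the result of rewriting, on nodes. -/
noncomputable def glue (c : S.compl.V) : S.ResultV :=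
  if h : ∃ l, S.f.onV l = c.1 then .inl (r.rhs (c.2 _ h.choose_spec).choose) else .inr ⟨c.1, h⟩

theorem glue_bdry (k : Fin r.i ⊕ Fin r.j) : S.glue (S.bdry k) = .inl (r.rhs k) := by
  have h : ∃ l, S.f.onV l = (S.bdry k).1 := ⟨_, rfl⟩
  rw [glue, dif_pos h]
  congr 2
  exact S.leftLinear (((S.bdry k).2 _ h.choose_spec).choose_spec.trans (S.injV h.choose_spec))

theorem glue_of_not_mem {c : S.compl.V} (h : ¬ ∃ l, S.f.onV l = c.1) :
    S.glue c = .inr ⟨c.1, h⟩ := dif_neg h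

theorem eq_bdry_or (c : S.compl.V) : (∃ k, c = S.bdry k) ∨ ¬ ∃ l, S.f.onV l = c.1 := by
  by_cases h : ∃ l, S.f.onV l = c.1
  · obtain ⟨l, hl⟩ := h
    obtain ⟨k, rfl⟩ := c.2 l hl
    exact .inl ⟨k, Subtype.ext hl.symm⟩
  · exact .inr h

theorem glue_eq_inl {c : S.compl.V} {v : r.R.V} (h : S.glue c = .inl v) :
    ∃ k, c = S.bdry k ∧ r.rhs k = v := by
  rcases S.eq_bdry_or c with ⟨k, rfl⟩ | hc
  · rw [glue_bdry] at h
    exact ⟨k, rfl, Sum.inl.inj h⟩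
  · rw [S.glue_of_not_mem hc] at h
    cases h

theorem glue_eq_inr {c : S.compl.V} {v : {v : G.V // ¬ ∃ l, S.f.onV l = v}}
    (h : S.glue c = .inr v) : c.1 = v.1 := by
  rcases S.eq_bdry_or c with ⟨k, rfl⟩ | hc
  · rw [glue_bdry] at h
    cases h
  · rw [S.glue_of_not_mem hc] at h
    exact congrArg Subtype.val (Sum.inr.inj h)

theorem glue_eq_glue {c c' : S.compl.V} (h : S.glue c = S.glue c') :
    c = c' ∨ ∃ k k', c = S.bdry k ∧ c' = S.bdry k' ∧ r.rhs k = r.rhs k' := by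
  rcases hc : S.glue c with v | v
  · obtain ⟨k, rfl, hk⟩ := S.glue_eq_inl hc
    obtain ⟨k', rfl, hk'⟩ := S.glue_eq_inl (h.symm.trans hc)
    exact .inr ⟨k, k', rfl, rfl, hk.trans hk'.symm⟩
  · exact .inl (Subtype.ext ((S.glue_eq_inr hc).trans (S.glue_eq_inr (h.symm.trans hc)).symm))

theorem glue_eq_inl_of_lhsOut {c : S.compl.V} {v : r.R.V} (h : S.glue c = .inl v)
    (hc : ∀ l, S.f.onV l = c.1 → ∃ y, r.lhsOut y = l) :
    ∃ y, c = S.bdry (.inr y) ∧ r.rhsOut y = v := by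
  obtain ⟨k, rfl, rfl⟩ := S.glue_eq_inl h
  obtain ⟨y, hy⟩ := hc _ rfl
  obtain rfl := S.leftLinear (a₁ := .inr y) hy
  exact ⟨y, rfl, rfl⟩

theorem glue_eq_inl_of_lhsIn {c : S.compl.V} {v : r.R.V} (h : S.glue c = .inl v)
    (hc : ∀ l, S.f.onV l = c.1 → ∃ x, r.lhsIn x = l) :
    ∃ x, c = S.bdry (.inl x) ∧ r.rhsIn x = v := by
  obtain ⟨k, rfl, rfl⟩ := S.glue_eq_inl h
  obtain ⟨x, hx⟩ := hc _ rfl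
  obtain rfl := S.leftLinear (a₁ := .inl x) hx
  exact ⟨x, rfl, rfl⟩

theorem glue_injOn_lhsOut :
    Set.InjOn S.glue {c | ∀ l, S.f.onV l = c.1 → ∃ y, r.lhsOut y = l} := by
  intro c hc c' hc' h
  rcases hv : S.glue c with v | v
  · obtain ⟨y, rfl, hy⟩ := S.glue_eq_inl_of_lhsOut hv hc
    obtain ⟨y', rfl, hy'⟩ := S.glue_eq_inl_of_lhsOut (h.symm.trans hv) hc'
    rw [MARule.rhsOut_injective (hy.trans hy'.symm)]
  · exact Subtype.ext ((S.glue_eq_inr hv).trans (S.glue_eq_inr (h.symm.trans hv)).symm)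

theorem glue_injOn_lhsIn :
    Set.InjOn S.glue {c | ∀ l, S.f.onV l = c.1 → ∃ x, r.lhsIn x = l} := by
  intro c hc c' hc' h
  rcases hv : S.glue c with v | v
  · obtain ⟨x, rfl, hx⟩ := S.glue_eq_inl_of_lhsIn hv hc
    obtain ⟨x', rfl, hx'⟩ := S.glue_eq_inl_of_lhsIn (h.symm.trans hv) hc'
    rw [MARule.rhsIn_injective (hx.trans hx'.symm)]
  · exact Subtype.ext ((S.glue_eq_inr hv).trans (S.glue_eq_inr (h.symm.trans hv)).symm)

theorem lhsOut_of_mem_compl_src {c : S.compl.V} {e : S.compl.E} (h : c ∈ S.compl.src e) :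
    ∀ l, S.f.onV l = c.1 → ∃ y, r.lhsOut y = l := fun _ hl =>
  S.exists_lhsOut_of_mem_src e.2 (hl ▸ S.mem_compl_src.1 h)

theorem lhsIn_of_mem_compl_tgt {c : S.compl.V} {e : S.compl.E} (h : c ∈ S.compl.tgt e) :
    ∀ l, S.f.onV l = c.1 → ∃ x, r.lhsIn x = l := fun _ hl =>
  S.exists_lhsIn_of_mem_tgt e.2 (hl ▸ S.mem_compl_tgt.1 h)

open Classical in
/-- The result of rewriting: the right-hand side glued to the boundary complement. -/
noncomputable def result : Hypergraph Sg ar coar where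
  V := S.ResultV
  E := r.R.E ⊕ S.compl.E
  fintV := inferInstance
  fintE := inferInstance
  label := Sum.elim r.R.label S.compl.label
  src := Sum.elim (fun e => (r.R.src e).map .inl) fun e => (S.compl.src e).map S.glue
  tgt := Sum.elim (fun e => (r.R.tgt e).map .inl) fun e => (S.compl.tgt e).map S.glue
  src_len e := by cases e <;> simp [Hypergraph.src_len]
  tgt_len e := by cases e <;> simp [Hypergraph.tgt_len]

/-- The comatch of the right-hand side. -/
noncomputable def comatch : Hom r.R S.result where
  onV := .inl
  onE := .inl
  label_eq _ := rfl
  src_eq _ := rfl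
  tgt_eq _ := rfl

/-- The morphism from the boundary complement to the result of rewriting. -/
noncomputable def toResult : Hom S.compl S.result where
  onV := S.glue
  onE := .inr
  label_eq _ := rfl
  src_eq _ := rfl
  tgt_eq _ := rfl

theorem mem_result_src_inl {e : r.R.E} {v : S.ResultV} :
    v ∈ S.result.src (.inl e) ↔ ∃ w ∈ r.R.src e, .inl w = v := List.mem_map

theorem mem_result_tgt_inl {e : r.R.E} {v : S.ResultV} :
    v ∈ S.result.tgt (.inl e) ↔ ∃ w ∈ r.R.tgt e, .inl w = v := List.mem_map

theorem mem_result_src_inr {e : S.compl.E} {v : S.ResultV} :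
    v ∈ S.result.src (.inr e) ↔ ∃ c ∈ S.compl.src e, S.glue c = v := List.mem_map

theorem mem_result_tgt_inr {e : S.compl.E} {v : S.ResultV} :
    v ∈ S.result.tgt (.inr e) ↔ ∃ c ∈ S.compl.tgt e, S.glue c = v := List.mem_map

/-! ### The squares of the rewriting step -/

theorem isPushout_incl :
    IsPushout (discHom r.L r.lhs) (discHom S.compl S.bdry) S.f S.incl := by
  refine .of_inter (Hom.ext_of_eq (fun _ => rfl) (fun e => e.elim)) S.convex.1 (fun v => ?_)
    (fun l c h => ?_) (fun c c' h => .inl (Subtype.ext h)) (fun e => ?_)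
    (fun e c h => absurd ⟨e, h⟩ c.2) (fun c c' h => .inl (Subtype.ext h))
  · by_cases h : ∃ l, S.f.onV l = v
    · exact .inl h
    · exact .inr ⟨⟨v, fun l hl => absurd ⟨l, hl⟩ h⟩, rfl⟩
  · obtain ⟨k, rfl⟩ := c.2 l h
    exact ⟨k, rfl, Subtype.ext h⟩
  · by_cases h : ∃ l, S.f.onE l = e
    · exact .inl h
    · exact .inr ⟨⟨e, h⟩, rfl⟩

theorem isPushout_toResult :
    IsPushout (discHom r.R r.rhs) (discHom S.compl S.bdry) S.comatch S.toResult := by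
  refine .of_inter (Hom.ext_of_eq (fun k => (S.glue_bdry k).symm) (fun e => e.elim))
    ⟨Sum.inl_injective, Sum.inl_injective⟩ ?_ (fun v c h => ?_) (fun c c' h => ?_) ?_
    (fun e c h => nomatch h) (fun c c' h => .inl (Sum.inr_injective h))
  · rintro (v | v)
    · exact .inl ⟨v, rfl⟩
    · exact .inr ⟨⟨v.1, fun l hl => absurd ⟨l, hl⟩ v.2⟩, S.glue_of_not_mem v.2⟩
  · obtain ⟨k, rfl, hk⟩ := S.glue_eq_inl h.symm
    exact ⟨k, hk, rfl⟩
  · rcases S.glue_eq_glue h with h | ⟨k, k', rfl, -, -⟩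
    · exact .inl h
    · exact .inr ⟨r.rhs k, (S.glue_bdry k).symm⟩
  · rintro (e | e)
    · exact .inl ⟨e, rfl⟩
    · exact .inr ⟨e, rfl⟩

/-! ### The boundary complement and the result are monogamous acyclic -/

theorem compl_isMA : S.compl.IsMA := by
  constructor
  · rw [Hypergraph.hasCycle_iff]
    rintro ⟨e, he⟩
    refine S.isMA.1 (Hypergraph.hasCycle_iff.2 ⟨e.1, he.lift Subtype.val ?_⟩)
    rintro a b ⟨v, hv, hv'⟩
    exact ⟨v.1, S.mem_compl_tgt.1 hv, S.mem_compl_src.1 hv'⟩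
  · refine Hypergraph.monogamous_iff.2 ⟨⟨fun e => ?_, fun v e e' h h' => ?_⟩,
      fun e => ?_, fun v e e' h h' => ?_⟩
    · exact .of_map Subtype.val (S.incl.tgt_eq e ▸ S.isMA.tgt_nodup e.1)
    · exact Subtype.ext (S.isMA.tgt_unique (S.mem_compl_tgt.1 h) (S.mem_compl_tgt.1 h'))
    · exact .of_map Subtype.val (S.incl.src_eq e ▸ S.isMA.src_nodup e.1)
    · exact Subtype.ext (S.isMA.src_unique (S.mem_compl_src.1 h) (S.mem_compl_src.1 h'))

theorem result_monogamous : S.result.Monogamous := by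
  have hR := Hypergraph.monogamous_iff.1 r.ma_rhs.1.2
  have hC := Hypergraph.monogamous_iff.1 S.compl_isMA.2
  refine Hypergraph.monogamous_iff.2 ⟨⟨?_, ?_⟩, ?_, ?_⟩
  · rintro (e | e)
    · exact (hR.1.1 e).map Sum.inl_injective
    · exact (hC.1.1 e).map_on fun c hc c' hc' h => S.glue_injOn_lhsIn
        (S.lhsIn_of_mem_compl_tgt hc) (S.lhsIn_of_mem_compl_tgt hc') h
  · have aux : ∀ v e e', v ∈ S.result.tgt (.inl e) → v ∈ S.result.tgt (.inr e') → False := by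
      intro v e e' h h'
      obtain ⟨w, hw, rfl⟩ := S.mem_result_tgt_inl.1 h
      obtain ⟨c, hc, hcw⟩ := S.mem_result_tgt_inr.1 h'
      obtain ⟨x, -, hx⟩ := S.glue_eq_inl_of_lhsIn hcw (S.lhsIn_of_mem_compl_tgt hc)
      exact MARule.exists_rhsIn_iff.1 ⟨x, hx⟩ e hw
    rintro v (e | e) (e' | e') h h'
    · obtain ⟨w, hw, rfl⟩ := S.mem_result_tgt_inl.1 h
      obtain ⟨w', hw', hww⟩ := S.mem_result_tgt_inl.1 h'
      obtain rfl := Sum.inl_injective hww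
      rw [hR.1.2 _ _ _ hw hw']
    · exact (aux _ _ _ h h').elim
    · exact (aux _ _ _ h' h).elim
    · obtain ⟨c, hc, rfl⟩ := S.mem_result_tgt_inr.1 h
      obtain ⟨c', hc', hcc⟩ := S.mem_result_tgt_inr.1 h'
      obtain rfl := S.glue_injOn_lhsIn (S.lhsIn_of_mem_compl_tgt hc')
        (S.lhsIn_of_mem_compl_tgt hc) hcc
      rw [hC.1.2 _ _ _ hc hc']
  · rintro (e | e)
    · exact (hR.2.1 e).map Sum.inl_injective
    · exact (hC.2.1 e).map_on fun c hc c' hc' h => S.glue_injOn_lhsOut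
        (S.lhsOut_of_mem_compl_src hc) (S.lhsOut_of_mem_compl_src hc') h
  · have aux : ∀ v e e', v ∈ S.result.src (.inl e) → v ∈ S.result.src (.inr e') → False := by
      intro v e e' h h'
      obtain ⟨w, hw, rfl⟩ := S.mem_result_src_inl.1 h
      obtain ⟨c, hc, hcw⟩ := S.mem_result_src_inr.1 h'
      obtain ⟨y, -, hy⟩ := S.glue_eq_inl_of_lhsOut hcw (S.lhsOut_of_mem_compl_src hc)
      exact MARule.exists_rhsOut_iff.1 ⟨y, hy⟩ e hw
    rintro v (e | e) (e' | e') h h'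
    · obtain ⟨w, hw, rfl⟩ := S.mem_result_src_inl.1 h
      obtain ⟨w', hw', hww⟩ := S.mem_result_src_inl.1 h'
      obtain rfl := Sum.inl_injective hww
      rw [hR.2.2 _ _ _ hw hw']
    · exact (aux _ _ _ h h').elim
    · exact (aux _ _ _ h' h).elim
    · obtain ⟨c, hc, rfl⟩ := S.mem_result_src_inr.1 h
      obtain ⟨c', hc', hcc⟩ := S.mem_result_src_inr.1 h'
      obtain rfl := S.glue_injOn_lhsOut (S.lhsOut_of_mem_compl_src hc')
        (S.lhsOut_of_mem_compl_src hc) hcc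
      exact congrArg Sum.inr (hC.2.2 _ _ _ hc hc')

/-- The hyperedges of `G` reachable from a hyperedge outside the match that leaves the match. -/
def After (e : G.E) : Prop :=
  ∃ (e₀ : G.E) (l : r.L.V), (¬ ∃ a, S.f.onE a = e₀) ∧ S.f.onV l ∈ G.src e₀ ∧
    Relation.ReflTransGen (EdgeStep G) e₀ e

theorem After.of_step {S : Redex r G} {e e' : G.E} (h : S.After e) (hs : EdgeStep G e e') :
    S.After e' :=
  let ⟨e₀, l, h1, h2, h3⟩ := h
  ⟨e₀, l, h1, h2, h3.tail hs⟩

theorem After.of_src {S : Redex r G} {e : S.compl.E} {k : Fin r.i ⊕ Fin r.j}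
    (h : S.bdry k ∈ S.compl.src e) : S.After e.1 :=
  ⟨e.1, _, e.2, S.mem_compl_src.1 h, .refl⟩

theorem not_after_of_tgt {e : S.compl.E} {k : Fin r.i ⊕ Fin r.j}
    (h : S.bdry k ∈ S.compl.tgt e) : ¬ S.After e.1 :=
  fun ⟨_, _, h1, h2, h3⟩ => h1 (S.convex.mem_range h2 h3 (S.mem_compl_tgt.1 h))

open Classical in
/-- Stratification of the hyperedges of the result, nondecreasing along paths: first the part of
the complement not after the match, then the right-hand side, then the part after the match. -/
noncomputable def level : r.R.E ⊕ S.compl.E → ℕ :=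
  Sum.elim (fun _ => 1) fun e => if S.After e.1 then 2 else 0

/-- A step inside one of the two parts of the result. -/
def LocalStep : r.R.E ⊕ S.compl.E → r.R.E ⊕ S.compl.E → Prop :=
  Sum.LiftRel (Relation.TransGen (EdgeStep r.R))
    fun e e' => Relation.TransGen (EdgeStep G) e.1 e'.1

theorem LocalStep.trans {S : Redex r G} {a b c : r.R.E ⊕ S.compl.E}
    (h : S.LocalStep a b) (h' : S.LocalStep b c) : S.LocalStep a c := by
  cases h with
  | inl h => cases h' with
    | inl h' => exact .inl (h.trans h')
  | inr h => cases h' with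
    | inr h' => exact .inr (h.trans h')

theorem level_of_step {a b : r.R.E ⊕ S.compl.E} (h : EdgeStep S.result a b) :
    S.level a < S.level b ∨ S.level a = S.level b ∧ S.LocalStep a b := by
  obtain ⟨v, hv, hv'⟩ := h
  rcases a with a | a <;> rcases b with b | b
  · obtain ⟨w, hw, rfl⟩ := S.mem_result_tgt_inl.1 hv
    obtain ⟨w', hw', hww⟩ := S.mem_result_src_inl.1 hv'
    obtain rfl := Sum.inl_injective hww
    exact .inr ⟨rfl, .inl (.single ⟨_, hw, hw'⟩)⟩
  · obtain ⟨w, hw, rfl⟩ := S.mem_result_tgt_inl.1 hv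
    obtain ⟨c, hc, hcw⟩ := S.mem_result_src_inr.1 hv'
    obtain ⟨k, rfl, -⟩ := S.glue_eq_inl hcw
    left
    simp [level, After.of_src hc]
  · obtain ⟨w, hw, rfl⟩ := S.mem_result_src_inl.1 hv'
    obtain ⟨c, hc, hcw⟩ := S.mem_result_tgt_inr.1 hv
    obtain ⟨k, rfl, -⟩ := S.glue_eq_inl hcw
    left
    simp [level, S.not_after_of_tgt hc]
  · obtain ⟨c, hc, rfl⟩ := S.mem_result_tgt_inr.1 hv
    obtain ⟨c', hc', hcc⟩ := S.mem_result_src_inr.1 hv'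
    rcases S.glue_eq_glue hcc with rfl | ⟨k', k, rfl, rfl, -⟩
    · have hs : EdgeStep G a.1 b.1 := ⟨_, S.mem_compl_tgt.1 hc, S.mem_compl_src.1 hc'⟩
      have hl : S.LocalStep (.inr a) (.inr b) := .inr (.single hs)
      by_cases ha : S.After a.1
      · exact .inr ⟨by simp [level, ha, ha.of_step hs], hl⟩
      · by_cases hb : S.After b.1
        · left
          simp [level, ha, hb]
        · exact .inr ⟨by simp [level, ha, hb], hl⟩
    · left
      simp [level, S.not_after_of_tgt hc, After.of_src hc']

theorem level_of_transGen {a b : r.R.E ⊕ S.compl.E}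
    (h : Relation.TransGen (EdgeStep S.result) a b) :
    S.level a < S.level b ∨ S.level a = S.level b ∧ S.LocalStep a b := by
  induction h with
  | single h => exact S.level_of_step h
  | tail _ h ih =>
    rcases ih with ih | ⟨ih, l⟩ <;> rcases S.level_of_step h with h | ⟨h, l'⟩
    · exact .inl (ih.trans h)
    · exact .inl (h ▸ ih)
    · exact .inl (ih ▸ h)
    · exact .inr ⟨ih.trans h, l.trans l'⟩

theorem result_isMA : S.result.IsMA := by
  refine ⟨?_, S.result_monogamous⟩
  rw [Hypergraph.hasCycle_iff]
  rintro ⟨e, he⟩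
  rcases S.level_of_transGen he with h | ⟨-, h⟩
  · exact lt_irrefl _ h
  · rcases e with e | e
    · exact r.ma_rhs.1.1 (Hypergraph.hasCycle_iff.2 ⟨e, Sum.liftRel_inl_inl.1 h⟩)
    · exact S.isMA.1 (Hypergraph.hasCycle_iff.2 ⟨e.1, (Sum.liftRel_inr_inr.1 h :)⟩)

/-! ### Interfaces -/

theorem lhsIn_of_isInput {v : G.V} (hv : G.IsInput v) :
    ∀ l, S.f.onV l = v → ∃ x, r.lhsIn x = l := fun _ hl =>
  S.exists_lhsIn_of_isInput (hl ▸ hv)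

theorem lhsOut_of_isOutput {v : G.V} (hv : G.IsOutput v) :
    ∀ l, S.f.onV l = v → ∃ y, r.lhsOut y = l := fun _ hl =>
  S.exists_lhsOut_of_isOutput (hl ▸ hv)

end Redex

namespace IsMACospan

variable {G : Hypergraph Sg ar coar} {α β : Type} {i : α → G.V} {o : β → G.V}

theorem isInput (h : IsMACospan G i o) (x : α) : G.IsInput (i x) :=
  h.2.2.1.subset ⟨x, rfl⟩

theorem isOutput (h : IsMACospan G i o) (y : β) : G.IsOutput (o y) :=
  h.2.2.2.2.subset ⟨y, rfl⟩

theorem exists_in (h : IsMACospan G i o) {v : G.V} (hv : G.IsInput v) : ∃ x, i x = v :=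
  h.2.2.1.superset hv

theorem exists_out (h : IsMACospan G i o) {v : G.V} (hv : G.IsOutput v) : ∃ y, o y = v :=
  h.2.2.2.2.superset hv

end IsMACospan

theorem Hypergraph.IsMA.exists_isMACospan {G : Hypergraph Sg ar coar} (hG : G.IsMA) :
    ∃ (a b : ℕ) (i : Fin a → G.V) (o : Fin b → G.V), IsMACospan G i o := by
  classical
  let eI := (Fintype.equivFin {v // G.IsInput v}).symm
  let eO := (Fintype.equivFin {v // G.IsOutput v}).symm
  refine ⟨_, _, fun x => (eI x).1, fun y => (eO y).1, hG,
    Subtype.val_injective.comp eI.injective, ?_, Subtype.val_injective.comp eO.injective, ?_⟩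
  · exact (eI.surjective.range_comp _).trans Subtype.range_val
  · exact (eO.surjective.range_comp _).trans Subtype.range_val

namespace Redex

variable {r : MARule Sg ar coar} {G : Hypergraph Sg ar coar} (S : Redex r G)
  {n m : ℕ} {gIn : Fin n → G.V} {gOut : Fin m → G.V}

/-- The inputs of `G` as nodes of the boundary complement. -/
def complIn (hG : IsMACospan G gIn gOut) (x : Fin n) : S.compl.V :=
  ⟨gIn x, S.keeps_of_lhsIn (S.lhsIn_of_isInput (hG.isInput x))⟩

/-- The outputs of `G` as nodes of the boundary complement. -/
def complOut (hG : IsMACospan G gIn gOut) (y : Fin m) : S.compl.V :=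
  ⟨gOut y, S.keeps_of_lhsOut (S.lhsOut_of_isOutput (hG.isOutput y))⟩

theorem not_mem_compl_tgt_bdry_inr (y : Fin r.j) (e : S.compl.E) :
    S.bdry (.inr y) ∉ S.compl.tgt e := fun h =>
  let ⟨x, hx⟩ := S.lhsIn_of_mem_compl_tgt h _ rfl
  S.leftLinear.lhsIn_ne_lhsOut x y hx

theorem not_mem_compl_src_bdry_inl (x : Fin r.i) (e : S.compl.E) :
    S.bdry (.inl x) ∉ S.compl.src e := fun h =>
  let ⟨y, hy⟩ := S.lhsOut_of_mem_compl_src h _ rfl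
  S.leftLinear.lhsIn_ne_lhsOut x y hy.symm

theorem not_mem_compl_tgt_complIn (hG : IsMACospan G gIn gOut) (x : Fin n) (e : S.compl.E) :
    S.complIn hG x ∉ S.compl.tgt e := fun h =>
  Hypergraph.isInput_iff.1 (hG.isInput x) _ (S.mem_compl_tgt.1 h)

theorem not_mem_compl_src_complOut (hG : IsMACospan G gIn gOut) (y : Fin m) (e : S.compl.E) :
    S.complOut hG y ∉ S.compl.src e := fun h =>
  Hypergraph.isOutput_iff.1 (hG.isOutput y) _ (S.mem_compl_src.1 h)

theorem exists_complIn (hG : IsMACospan G gIn gOut) {c : S.compl.V}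
    (hc : ∀ e, c ∉ S.compl.tgt e) (hl : ∀ l e, S.f.onV l = c.1 → l ∉ r.L.tgt e) :
    ∃ x, S.complIn hG x = c := by
  obtain ⟨x, hx⟩ := hG.exists_in (v := c.1) <| Hypergraph.isInput_iff.2 fun e he => by
    by_cases h : ∃ e₀, S.f.onE e₀ = e
    · obtain ⟨e₀, rfl⟩ := h
      rw [S.f.tgt_eq] at he
      obtain ⟨l, hl', hlc⟩ := List.mem_map.1 he
      exact hl l e₀ hlc hl'
    · exact hc ⟨e, h⟩ (S.mem_compl_tgt.2 he)
  exact ⟨x, Subtype.ext hx⟩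

theorem exists_complOut (hG : IsMACospan G gIn gOut) {c : S.compl.V}
    (hc : ∀ e, c ∉ S.compl.src e) (hl : ∀ l e, S.f.onV l = c.1 → l ∉ r.L.src e) :
    ∃ y, S.complOut hG y = c := by
  obtain ⟨y, hy⟩ := hG.exists_out (v := c.1) <| Hypergraph.isOutput_iff.2 fun e he => by
    by_cases h : ∃ e₀, S.f.onE e₀ = e
    · obtain ⟨e₀, rfl⟩ := h
      rw [S.f.src_eq] at he
      obtain ⟨l, hl', hlc⟩ := List.mem_map.1 he
      exact hl l e₀ hlc hl'
    · exact hc ⟨e, h⟩ (S.mem_compl_src.2 he)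
  exact ⟨y, Subtype.ext hy⟩

theorem compl_isMACospan (hG : IsMACospan G gIn gOut) :
    IsMACospan S.compl (Sum.elim (fun y => S.bdry (.inr y)) (S.complIn hG))
      (Sum.elim (S.complOut hG) fun x => S.bdry (.inl x)) := by
  refine ⟨S.compl_isMA, ?_, ?_, ?_, ?_⟩
  · refine Function.Injective.sumElim (S.bdry_injective.comp Sum.inr_injective)
      (fun x x' h => hG.2.1 (congrArg Subtype.val h)) fun y x h => ?_
    obtain ⟨x', hx'⟩ := S.lhsIn_of_isInput (hG.isInput x) _ (congrArg Subtype.val h)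
    exact S.leftLinear.lhsIn_ne_lhsOut x' y hx'
  · ext c
    rw [Set.mem_ofPred_eq, Hypergraph.isInput_iff]
    constructor
    · rintro ⟨y | x, rfl⟩
      · exact S.not_mem_compl_tgt_bdry_inr y
      · exact S.not_mem_compl_tgt_complIn hG x
    · intro hc
      by_cases hk : ∃ y, S.bdry (.inr y) = c
      · obtain ⟨y, hy⟩ := hk
        exact ⟨.inl y, hy⟩
      · obtain ⟨x, hx⟩ := S.exists_complIn hG hc fun l e hl he => by
          obtain ⟨x | y, rfl⟩ := c.2 l hl
          · exact MARule.exists_lhsIn_iff.1 ⟨x, rfl⟩ e he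
          · exact hk ⟨y, Subtype.ext hl⟩
        exact ⟨.inr x, hx⟩
  · refine Function.Injective.sumElim (fun y y' h => hG.2.2.2.1 (congrArg Subtype.val h))
      (S.bdry_injective.comp Sum.inl_injective) fun y x h => ?_
    obtain ⟨y', hy'⟩ := S.lhsOut_of_isOutput (hG.isOutput y) _ (congrArg Subtype.val h).symm
    exact S.leftLinear.lhsIn_ne_lhsOut x y' hy'.symm
  · ext c
    rw [Set.mem_ofPred_eq, Hypergraph.isOutput_iff]
    constructor
    · rintro ⟨y | x, rfl⟩
      · exact S.not_mem_compl_src_complOut hG y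
      · exact S.not_mem_compl_src_bdry_inl x
    · intro hc
      by_cases hk : ∃ x, S.bdry (.inl x) = c
      · obtain ⟨x, hx⟩ := hk
        exact ⟨.inr x, hx⟩
      · obtain ⟨y, hy⟩ := S.exists_complOut hG hc fun l e hl he => by
          obtain ⟨x | y, rfl⟩ := c.2 l hl
          · exact hk ⟨x, Subtype.ext hl⟩
          · exact MARule.exists_lhsOut_iff.1 ⟨y, rfl⟩ e he
        exact ⟨.inl y, hy⟩

theorem result_isMACospan (hG : IsMACospan G gIn gOut) :
    IsMACospan S.result (S.toResult.onV ∘ S.complIn hG) (S.toResult.onV ∘ S.complOut hG) := by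
  have hIn : ∀ x, ∀ l, S.f.onV l = (S.complIn hG x).1 → ∃ x, r.lhsIn x = l :=
    fun x => S.lhsIn_of_isInput (hG.isInput x)
  have hOut : ∀ y, ∀ l, S.f.onV l = (S.complOut hG y).1 → ∃ y, r.lhsOut y = l :=
    fun y => S.lhsOut_of_isOutput (hG.isOutput y)
  refine ⟨S.result_isMA, ?_, ?_, ?_, ?_⟩
  · intro x x' h
    exact hG.2.1 (congrArg Subtype.val (S.glue_injOn_lhsIn (hIn x) (hIn x') h))
  · ext v
    rw [Set.mem_ofPred_eq, Hypergraph.isInput_iff]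
    constructor
    · rintro ⟨x, rfl⟩ (e | e) h
      · obtain ⟨w, hw, hwv⟩ := S.mem_result_tgt_inl.1 h
        obtain ⟨x', -, rfl⟩ := S.glue_eq_inl_of_lhsIn hwv.symm (hIn x)
        exact MARule.exists_rhsIn_iff.1 ⟨x', rfl⟩ e hw
      · obtain ⟨c, hc, hcv⟩ := S.mem_result_tgt_inr.1 h
        obtain rfl := S.glue_injOn_lhsIn (S.lhsIn_of_mem_compl_tgt hc) (hIn x) hcv
        exact S.not_mem_compl_tgt_complIn hG x e hc
    · intro hv
      have hv' : ∀ (c : S.compl.V), S.glue c = v → ∀ e, c ∉ S.compl.tgt e :=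
        fun c hc e he => hv (.inr e) (S.mem_result_tgt_inr.2 ⟨c, he, hc⟩)
      rcases v with v | v
      · obtain ⟨x, rfl⟩ := MARule.exists_rhsIn_iff.2 fun e he =>
          hv (.inl e) (S.mem_result_tgt_inl.2 ⟨v, he, rfl⟩)
        have hx := S.glue_bdry (.inl x)
        obtain ⟨a, ha⟩ := S.exists_complIn hG (hv' _ hx) fun l e hl he => by
          obtain rfl := S.injV hl
          exact MARule.exists_lhsIn_iff.1 ⟨x, rfl⟩ e he
        exact ⟨a, (congrArg S.glue ha).trans hx⟩
      · let c : S.compl.V := ⟨v.1, fun l hl => absurd ⟨l, hl⟩ v.2⟩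
        have hc : S.glue c = .inr v := S.glue_of_not_mem v.2
        obtain ⟨a, ha⟩ := S.exists_complIn hG (hv' _ hc) fun l e hl => absurd ⟨l, hl⟩ v.2
        exact ⟨a, (congrArg S.glue ha).trans hc⟩
  · intro y y' h
    exact hG.2.2.2.1 (congrArg Subtype.val (S.glue_injOn_lhsOut (hOut y) (hOut y') h))
  · ext v
    rw [Set.mem_ofPred_eq, Hypergraph.isOutput_iff]
    constructor
    · rintro ⟨y, rfl⟩ (e | e) h
      · obtain ⟨w, hw, hwv⟩ := S.mem_result_src_inl.1 h
        obtain ⟨y', -, rfl⟩ := S.glue_eq_inl_of_lhsOut hwv.symm (hOut y)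
        exact MARule.exists_rhsOut_iff.1 ⟨y', rfl⟩ e hw
      · obtain ⟨c, hc, hcv⟩ := S.mem_result_src_inr.1 h
        obtain rfl := S.glue_injOn_lhsOut (S.lhsOut_of_mem_compl_src hc) (hOut y) hcv
        exact S.not_mem_compl_src_complOut hG y e hc
    · intro hv
      have hv' : ∀ (c : S.compl.V), S.glue c = v → ∀ e, c ∉ S.compl.src e :=
        fun c hc e he => hv (.inr e) (S.mem_result_src_inr.2 ⟨c, he, hc⟩)
      rcases v with v | v
      · obtain ⟨y, rfl⟩ := MARule.exists_rhsOut_iff.2 fun e he =>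
          hv (.inl e) (S.mem_result_src_inl.2 ⟨v, he, rfl⟩)
        have hy := S.glue_bdry (.inr y)
        obtain ⟨a, ha⟩ := S.exists_complOut hG (hv' _ hy) fun l e hl he => by
          obtain rfl := S.injV hl
          exact MARule.exists_lhsOut_iff.1 ⟨y, rfl⟩ e he
        exact ⟨a, (congrArg S.glue ha).trans hy⟩
      · let c : S.compl.V := ⟨v.1, fun l hl => absurd ⟨l, hl⟩ v.2⟩
        have hc : S.glue c = .inr v := S.glue_of_not_mem v.2
        obtain ⟨a, ha⟩ := S.exists_complOut hG (hv' _ hc) fun l e hl => absurd ⟨l, hl⟩ v.2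
        exact ⟨a, (congrArg S.glue ha).trans hc⟩

theorem elim_bdry :
    Sum.elim (fun x => S.bdry (.inl x)) (fun y => S.bdry (.inr y)) = S.bdry :=
  Sum.elim_comp_inl_inr S.bdry

/-- The convex rewriting step at a redex. -/
noncomputable def step (hG : IsMACospan G gIn gOut) :
    StepData r G gIn gOut S.result
      (S.toResult.onV ∘ S.complIn hG) (S.toResult.onV ∘ S.complOut hG) where
  f := S.f
  C := S.compl
  c1 x := S.bdry (.inl x)
  c2 y := S.bdry (.inr y)
  g := S.incl
  h := S.toResult
  comatch := S.comatch
  d1 := S.complIn hG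
  d2 := S.complOut hG
  maD := hG
  maE := S.result_isMACospan hG
  convex := S.convex
  po_left := by
    rw [elim_bdry]
    exact S.isPushout_incl
  c_mono := by
    rw [elim_bdry]
    exact S.bdry_injective
  g_d1 := rfl
  g_d2 := rfl
  bc_ma := S.compl_isMACospan hG
  po_right := by
    rw [elim_bdry]
    exact S.isPushout_toResult
  h_d1 := rfl
  h_d2 := rfl

/-! ### Extending a rewriting step along a mono -/

section Extend

variable {P : Hypergraph Sg ar coar} {p : Hom G P} (hp : IsMono p) (T : Redex r P)
  (hT : p.comp S.f = T.f)

theorem onV_comp {S : Redex r G} {T : Redex r P} (hT : p.comp S.f = T.f) (l : r.L.V) :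
    T.f.onV l = p.onV (S.f.onV l) := by
  rw [← hT]
  rfl

theorem onE_comp {S : Redex r G} {T : Redex r P} (hT : p.comp S.f = T.f) (e : r.L.E) :
    T.f.onE e = p.onE (S.f.onE e) := by
  rw [← hT]
  rfl

theorem exists_onV_iff {S : Redex r G} {T : Redex r P} (hp : IsMono p) (hT : p.comp S.f = T.f)
    (v : G.V) : (∃ l, T.f.onV l = p.onV v) ↔ ∃ l, S.f.onV l = v :=
  exists_congr fun l => by rw [onV_comp hT, hp.1.eq_iff]

theorem exists_onE_iff {S : Redex r G} {T : Redex r P} (hp : IsMono p) (hT : p.comp S.f = T.f)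
    (e : G.E) : (∃ l, T.f.onE l = p.onE e) ↔ ∃ l, S.f.onE l = e :=
  exists_congr fun l => by rw [onE_comp hT, hp.2.eq_iff]

theorem keeps_iff {S : Redex r G} {T : Redex r P} (hp : IsMono p) (hT : p.comp S.f = T.f)
    (v : G.V) : T.Keeps (p.onV v) ↔ S.Keeps v :=
  forall_congr' fun l => by rw [onV_comp hT, hp.1.eq_iff]

/-- The map on nodes of boundary complements induced by a mono `G → P`. -/
def complMapV (c : S.compl.V) : T.compl.V :=
  ⟨p.onV c.1, (keeps_iff hp hT c.1).2 c.2⟩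

/-- The morphism between boundary complements induced by a mono `G → P`. -/
noncomputable def complMap : Hom S.compl T.compl where
  onV := S.complMapV hp T hT
  onE e := ⟨p.onE e.1, fun h => e.2 ((exists_onE_iff hp hT e.1).1 h)⟩
  label_eq e := p.label_eq e.1
  src_eq e := Subtype.val_injective.list_map <| by
    refine (T.incl.src_eq _).symm.trans ((p.src_eq e.1).trans ?_)
    refine (congrArg (List.map p.onV) (S.incl.src_eq e)).trans ?_
    exact (List.map_map (g := p.onV) (f := Subtype.val)).trans
      (List.map_map (g := Subtype.val) (f := S.complMapV hp T hT) (l := S.compl.src e)).symm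
  tgt_eq e := Subtype.val_injective.list_map <| by
    refine (T.incl.tgt_eq _).symm.trans ((p.tgt_eq e.1).trans ?_)
    refine (congrArg (List.map p.onV) (S.incl.tgt_eq e)).trans ?_
    exact (List.map_map (g := p.onV) (f := Subtype.val)).trans
      (List.map_map (g := Subtype.val) (f := S.complMapV hp T hT) (l := S.compl.tgt e)).symm

/-- The map on nodes of the results of rewriting induced by a mono `G → P`. -/
def resultMapV : S.ResultV → T.ResultV :=
  Sum.map id fun v => ⟨p.onV v.1, fun h => v.2 ((exists_onV_iff hp hT v.1).1 h)⟩

theorem complMap_bdry (k : Fin r.i ⊕ Fin r.j) :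
    (S.complMap hp T hT).onV (S.bdry k) = T.bdry k :=
  Subtype.ext (onV_comp hT _).symm

theorem glue_complMap (c : S.compl.V) :
    T.glue ((S.complMap hp T hT).onV c) = S.resultMapV hp T hT (S.glue c) := by
  rcases S.eq_bdry_or c with ⟨k, rfl⟩ | hc
  · rw [complMap_bdry, glue_bdry, glue_bdry]
    rfl
  · rw [S.glue_of_not_mem hc]
    exact T.glue_of_not_mem fun h => hc ((exists_onV_iff hp hT c.1).1 h)

/-- The morphism between the results of rewriting induced by a mono `G → P`. -/
noncomputable def resultMap : Hom S.result T.result where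
  onV := S.resultMapV hp T hT
  onE := Sum.map id (S.complMap hp T hT).onE
  label_eq := by
    rintro (e | e)
    · rfl
    · exact (S.complMap hp T hT).label_eq e
  src_eq := by
    rintro (e | e)
    · exact (List.map_map (g := S.resultMapV hp T hT) (f := Sum.inl) (l := r.R.src e)).symm
    · refine (congrArg (List.map T.glue) ((S.complMap hp T hT).src_eq e)).trans ?_
      refine (List.map_map ..).trans (Eq.trans ?_ (List.map_map ..).symm)
      exact List.map_congr_left fun c _ => S.glue_complMap hp T hT c
  tgt_eq := by
    rintro (e | e)
    · exact (List.map_map (g := S.resultMapV hp T hT) (f := Sum.inl) (l := r.R.tgt e)).symm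
    · refine (congrArg (List.map T.glue) ((S.complMap hp T hT).tgt_eq e)).trans ?_
      refine (List.map_map ..).trans (Eq.trans ?_ (List.map_map ..).symm)
      exact List.map_congr_left fun c _ => S.glue_complMap hp T hT c

theorem resultMap_isMono : IsMono (S.resultMap hp T hT) := by
  refine ⟨Sum.map_injective.2 ⟨Function.injective_id, fun v v' h => ?_⟩,
    Sum.map_injective.2 ⟨Function.injective_id, fun e e' h => ?_⟩⟩
  · exact Subtype.ext (hp.1 (congrArg Subtype.val h))
  · exact Subtype.ext (hp.2 (congrArg Subtype.val h))

theorem isPushout_complMap_incl :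
    IsPushout S.incl (S.complMap hp T hT) p T.incl := by
  refine .of_inter rfl hp (fun v => ?_) (fun v c h => ?_) (fun c c' h => .inl (Subtype.ext h))
    (fun e => ?_) (fun e c h => ?_) (fun c c' h => .inl (Subtype.ext h))
  · by_cases h : ∃ l, T.f.onV l = v
    · obtain ⟨l, rfl⟩ := h
      exact .inl ⟨S.f.onV l, (onV_comp hT l).symm⟩
    · exact .inr ⟨⟨v, fun l hl => absurd ⟨l, hl⟩ h⟩, rfl⟩
  · exact ⟨⟨v, (keeps_iff hp hT v).1 (h ▸ c.2)⟩, rfl, Subtype.ext h⟩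
  · by_cases h : ∃ l, T.f.onE l = e
    · obtain ⟨l, rfl⟩ := h
      exact .inl ⟨S.f.onE l, (onE_comp hT l).symm⟩
    · exact .inr ⟨⟨e, h⟩, rfl⟩
  · exact ⟨⟨e, fun h' => c.2 <| by
      obtain ⟨l, hl⟩ := (exists_onE_iff hp hT e).2 h'
      exact ⟨l, hl.trans h⟩⟩, rfl, Subtype.ext h⟩

theorem isPushout_complMap_toResult :
    IsPushout S.toResult (S.complMap hp T hT) (S.resultMap hp T hT) T.toResult := by
  refine .of_inter (Hom.ext_of_eq (fun c => (S.glue_complMap hp T hT c).symm) fun _ => rfl)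
    (S.resultMap_isMono hp T hT) ?_ ?_ (fun c c' h => ?_) ?_ ?_
    (fun c c' h => .inl (Sum.inr_injective h))
  · rintro (v | v)
    · exact .inl ⟨.inl v, rfl⟩
    · exact .inr ⟨⟨v.1, fun l hl => absurd ⟨l, hl⟩ v.2⟩, T.glue_of_not_mem v.2⟩
  · rintro (v | v) c h
    · obtain ⟨k, rfl, rfl⟩ := T.glue_eq_inl h.symm
      exact ⟨S.bdry k, S.glue_bdry k, S.complMap_bdry hp T hT k⟩
    · exact ⟨⟨v.1, fun l hl => absurd ⟨l, hl⟩ v.2⟩, S.glue_of_not_mem v.2,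
        Subtype.ext (T.glue_eq_inr h.symm).symm⟩
  · rcases T.glue_eq_glue h with h | ⟨k, k', rfl, -, -⟩
    · exact .inl h
    · exact .inr ⟨.inl (r.rhs k), (T.glue_bdry k).symm⟩
  · rintro (e | e)
    · exact .inl ⟨.inl e, rfl⟩
    · exact .inr ⟨e, rfl⟩
  · rintro (e | e) c h
    · cases h
    · exact ⟨e, rfl, Sum.inr_injective h⟩

end Extend

end Redex

/-- A mono is factored through by any morphism whose image it contains. -/
theorem exists_factor {L G P : Hypergraph Sg ar coar} {p : Hom G P} (hp : IsMono p) (m : Hom L P)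
    (hV : ∀ l, ∃ v, p.onV v = m.onV l) (hE : ∀ l, ∃ e, p.onE e = m.onE l) :
    ∃ m' : Hom L G, p.comp m' = m := by
  choose fV hfV using hV
  choose fE hfE using hE
  have h : p.onV ∘ fV = m.onV := funext hfV
  refine ⟨⟨fV, fE, fun e => ?_, fun e => hp.1.list_map ?_, fun e => hp.1.list_map ?_⟩,
    Hom.ext_of_eq hfV hfE⟩
  · rw [← p.label_eq, hfE, m.label_eq]
  · rw [← p.src_eq, hfE, m.src_eq, List.map_map, h]
  · rw [← p.tgt_eq, hfE, m.tgt_eq, List.map_map, h]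

theorem EdgeStep.map {G P : Hypergraph Sg ar coar} (p : Hom G P) {e e' : G.E}
    (h : EdgeStep G e e') : EdgeStep P (p.onE e) (p.onE e') := by
  obtain ⟨v, hv, hv'⟩ := h
  exact ⟨p.onV v, p.tgt_eq e ▸ List.mem_map_of_mem hv, p.src_eq e' ▸ List.mem_map_of_mem hv'⟩

theorem IsConvexMatch.of_comp {L G P : Hypergraph Sg ar coar} {p : Hom G P} {m : Hom L G}
    (hp : IsMono p) (h : IsConvexMatch (p.comp m)) : IsConvexMatch m := by
  refine ⟨⟨.of_comp h.1.1, .of_comp h.1.2⟩, fun v v' l hl hc hv hv' e he => ?_⟩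
  obtain ⟨e₀, he₀⟩ := h.2 v v' (l.map p.onE) (by simpa using hl)
    ((List.isChain_map _).2 (hc.imp fun _ _ => EdgeStep.map p))
    (by rw [List.head_map, p.src_eq]; exact List.mem_map_of_mem hv)
    (by rw [List.getLast_map, p.tgt_eq]; exact List.mem_map_of_mem hv')
    (p.onE e) (List.mem_map_of_mem he)
  exact ⟨e₀, hp.2 he₀⟩

/-- rewriting cuts along path extensions: a convex match of the
left-hand side of a left-linear ma-rule over Σ into a path extension `P` of
`G'` factors through `G'`, the convex rewrite of `G'` exists and extends to the
convex rewriting step of `P` via pushouts, and the resulting mono `q : H' → Q`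
is again a path extension. -/
theorem rewriting_cuts_along_path_extension {Sg : Type} {ar coar : Sg → ℕ}
    {nP mP : ℕ} (r : MARule (ESig Sg) (ear ar) (ecoar coar))
    (hr : r.IsLeftLinear) (hrL : Pure r.L) (hrR : Pure r.R)
    (G' P : EHypergraph Sg ar coar) (hG' : G'.IsMA) (hG'pure : Pure G')
    (p : Hom G' P) (hp : IsPathExt p)
    (pIn : Fin nP → P.V) (pOut : Fin mP → P.V) (hmaP : IsMACospan P pIn pOut)
    (m : Hom r.L P) (hconv : IsConvexMatch m)
    (hbc : Nonempty (BoundaryComplement r.lhsIn r.lhsOut pIn pOut m)) :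
    ∃ (m' : Hom r.L G'), IsMono m' ∧ p.comp m' = m ∧
      ∃ (a b : ℕ) (gIn : Fin a → G'.V) (gOut : Fin b → G'.V)
        (H' : EHypergraph Sg ar coar) (hIn : Fin a → H'.V) (hOut : Fin b → H'.V)
        (sd : StepData r G' gIn gOut H' hIn hOut)
        (Q : EHypergraph Sg ar coar) (qIn : Fin nP → Q.V) (qOut : Fin mP → Q.V)
        (sdP : StepData r P pIn pOut Q qIn qOut)
        (cd : Hom sd.C sdP.C) (q : Hom H' Q),
        sd.f = m' ∧ sdP.f = m ∧
        IsPushout sd.g cd p sdP.g ∧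
        IsPushout sd.h cd q sdP.h ∧
        sdP.comatch = q.comp sd.comatch ∧
        IsPathExt q := by
  have hE : ∀ e, ∃ e₀, p.onE e₀ = m.onE e := by
    intro e
    by_contra h
    have h1 := hp.2 _ h
    rw [m.label_eq] at h1
    have h2 := hrL e
    cases hl : r.L.label e <;> simp [hl] at h1 h2
  have hV : ∀ l, ∃ v, p.onV v = m.onV l := by
    intro l
    obtain ⟨e, he⟩ := hr.exists_edge l
    obtain ⟨e₀, he₀⟩ := hE e
    rcases he with he | he
    · have := List.mem_map_of_mem (f := m.onV) he
      rw [← m.src_eq, ← he₀, p.src_eq] at this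
      obtain ⟨v, -, hv⟩ := List.mem_map.1 this
      exact ⟨v, hv⟩
    · have := List.mem_map_of_mem (f := m.onV) he
      rw [← m.tgt_eq, ← he₀, p.tgt_eq] at this
      obtain ⟨v, -, hv⟩ := List.mem_map.1 this
      exact ⟨v, hv⟩
  obtain ⟨m', hm'⟩ := exists_factor hp.1 m hV hE
  have hconv' : IsConvexMatch m' := .of_comp hp.1 (hm' ▸ hconv)
  obtain ⟨a, b, gIn, gOut, hG⟩ := hG'.exists_isMACospan
  let S : Redex r G' := ⟨m', hr, hG', hconv'⟩
  let T : Redex r P := ⟨m, hr, hmaP.1, hconv⟩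
  refine ⟨m', hconv'.1, hm', a, b, gIn, gOut, S.result, _, _, S.step hG, T.result, _, _,
    T.step hmaP, S.complMap hp.1 T hm', S.resultMap hp.1 T hm', rfl, rfl,
    S.isPushout_complMap_incl hp.1 T hm', S.isPushout_complMap_toResult hp.1 T hm', rfl,
    S.resultMap_isMono hp.1 T hm', ?_⟩
  rintro (e | e) he
  · exact absurd ⟨.inl e, rfl⟩ he
  · refine hp.2 e.1 fun ⟨e₀, he₀⟩ => he ⟨.inr ⟨e₀, fun h => e.2 ?_⟩, ?_⟩
    · exact he₀ ▸ (Redex.exists_onE_iff (S := S) (T := T) hp.1 hm' e₀).2 h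
    · exact congrArg Sum.inr (Subtype.ext he₀)

end HypRw
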